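/- For every n ≥ 1, the abelian complexity function of the ordinary paperfolding word satisfies ρ(n) = M(n) + 1, where M(n) is the maximum of Δ(w) = |w|_0 − |w|_1 over all factors w of f of length n. -/

import Mathlib

/-- The ordinary paperfolding word over `{0,1}`, indexed from 1:
writing `n = n' * 2^k` with `n'` odd, `pf n = 0` if `n' ≡ 1 (mod 4)`
and `pf n = 1` if `n' ≡ 3 (mod 4)`.  (The value at `0` is irrelevant.) -/
def pf (n : ℕ) : ℕ := if (n / 2 ^ (n.factorization 2)) % 4 = 1 then 0 else 1

/-- The factor `f_i f_{i+1} ⋯ f_{i+n-1}` of the paperfolding word,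
of length `n`, starting at position `i`. -/
def pfFactor (i n : ℕ) : List ℕ := (List.range n).map (fun j => pf (i + j))

/-- `w` is a factor of the ordinary paperfolding word. -/
def IsPFFactor (w : List ℕ) : Prop := ∃ i : ℕ, 1 ≤ i ∧ w = pfFactor i w.length

/-- The abelian complexity function of the ordinary paperfolding word:
the number of abelian equivalence classes of factors of length `n`,
where the class of a factor `w` is determined by the pair
`(|w|_0, |w|_1)` of numbers of occurrences of `0` and `1` in `w`. -/
noncomputable def ρ (n : ℕ) : ℕ :=
  {p : ℕ × ℕ | ∃ i : ℕ, 1 ≤ i ∧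
    p = ((pfFactor i n).count 0, (pfFactor i n).count 1)}.ncard

/-- `Δ w = |w|_0 - |w|_1`. -/
def Δ (w : List ℕ) : ℤ := (w.count 0 : ℤ) - (w.count 1 : ℤ)

/-- `M n` is the maximum of `Δ w` over all factors `w` of the
paperfolding word of length `n`. -/
noncomputable def M (n : ℕ) : ℤ :=
  sSup {d : ℤ | ∃ i : ℕ, 1 ≤ i ∧ d = Δ (pfFactor i n)}

lemma pf_le_one (n : ℕ) : pf n ≤ 1 := by
  unfold pf; split_ifs <;> simp

lemma pf_two_mul (n : ℕ) (hn : n ≠ 0) : pf (2 * n) = pf n := by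
  have h : (2 * n).factorization 2 = n.factorization 2 + 1 := by
    rw [Nat.factorization_mul two_ne_zero hn, Finsupp.add_apply,
      Nat.prime_two.factorization_self, add_comm]
  unfold pf
  rw [h, pow_succ', Nat.mul_div_mul_left _ _ two_pos]

lemma pf_of_odd (n : ℕ) (hn : n % 2 = 1) : pf n = if n % 4 = 1 then 0 else 1 := by
  have h : n.factorization 2 = 0 := Nat.factorization_eq_zero_of_not_dvd (by omega)
  simp [pf, h]

/-- The first half of a block of length `2 ^ (k + 1)` is the reversed complement of the second. -/
lemma pf_reflect (k m : ℕ) (h1 : 1 ≤ m) (h2 : m < 2 ^ k) :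
    pf (2 ^ (k + 1) - m) + pf m = 1 := by
  induction k generalizing m with
  | zero => omega
  | succ k ih =>
    rcases Nat.even_or_odd' m with ⟨r, rfl | rfl⟩
    · have hr : r < 2 ^ k := by rw [pow_succ] at h2; omega
      have e : 2 ^ (k + 1 + 1) - 2 * r = 2 * (2 ^ (k + 1) - r) := by
        rw [pow_succ _ (k + 1)]; omega
      rw [e, pf_two_mul _ (by rw [pow_succ]; omega), pf_two_mul _ (by omega)]
      exact ih r (by omega) hr
    · have e : 2 ^ (k + 1 + 1) = 4 * 2 ^ k := by ring
      have e' : 2 ^ (k + 1) = 2 * 2 ^ k := by ring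
      rw [pf_of_odd _ (by omega), pf_of_odd _ (by omega)]
      split_ifs <;> omega

/-- The number of ones in the factor of length `n` starting at `i`. -/
def pfOnes (n i : ℕ) : ℕ := ∑ j ∈ Finset.range n, pf (i + j)

lemma pfFactor_succ (i n : ℕ) : pfFactor i (n + 1) = pfFactor i n ++ [pf (i + n)] := by
  simp [pfFactor, List.range_succ]

lemma count_one_pfFactor (i n : ℕ) : (pfFactor i n).count 1 = pfOnes n i := by
  induction n with
  | zero => simp [pfFactor, pfOnes]
  | succ n ih =>
    have h := pf_le_one (i + n)
    rw [pfFactor_succ, List.count_append, ih, pfOnes, pfOnes, Finset.sum_range_succ]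
    interval_cases pf (i + n) <;> simp

lemma count_zero_add_pfOnes (i n : ℕ) : (pfFactor i n).count 0 + pfOnes n i = n := by
  induction n with
  | zero => simp [pfFactor, pfOnes]
  | succ n ih =>
    have h := pf_le_one (i + n)
    rw [pfOnes] at ih
    rw [pfFactor_succ, List.count_append, pfOnes, Finset.sum_range_succ]
    interval_cases pf (i + n) <;> simp <;> omega

lemma pfOnes_step (n i : ℕ) : pfOnes n (i + 1) + pf i = pfOnes n i + pf (i + n) := by
  have h : pfOnes (n + 1) i = pfOnes n i + pf (i + n) := Finset.sum_range_succ _ _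
  rw [← h, pfOnes, pfOnes, Finset.sum_range_succ']
  simp [add_assoc, add_comm 1]

lemma exists_pfOnes_reflect (n i : ℕ) (hi : 1 ≤ i) :
    ∃ i', 1 ≤ i' ∧ pfOnes n i' + pfOnes n i = n := by
  have hk : i + n < 2 ^ (i + n) := Nat.lt_two_pow_self
  have e : 2 ^ (i + n + 1) = 2 * 2 ^ (i + n) := by ring
  refine ⟨2 ^ (i + n + 1) - (i + n - 1), by omega, ?_⟩
  unfold pfOnes
  rw [← Finset.sum_range_reflect (fun j => pf (i + j)), ← Finset.sum_add_distrib]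
  conv_rhs => rw [← Finset.card_range n, Finset.card_eq_sum_ones]
  refine Finset.sum_congr rfl fun j hj => ?_
  rw [Finset.mem_range] at hj
  have h := pf_reflect (i + n) (i + (n - 1 - j)) (by omega) (by omega)
  rwa [show 2 ^ (i + n + 1) - (i + (n - 1 - j)) = 2 ^ (i + n + 1) - (i + n - 1) + j by omega] at h

/-- Discrete intermediate value theorem for sequences with steps at most one. -/
lemma exists_eq_of_step_le_one (f : ℕ → ℕ) (hf : ∀ k, f (k + 1) ≤ f k + 1 ∧ f k ≤ f (k + 1) + 1)
    {i j : ℕ} (hij : i ≤ j) (c : ℕ) (hc : f i ≤ c ∧ c ≤ f j ∨ f j ≤ c ∧ c ≤ f i) :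
    ∃ l, i ≤ l ∧ f l = c := by
  induction j, hij using Nat.le_induction with
  | base => exact ⟨i, le_rfl, by omega⟩
  | succ j hij ih =>
    by_cases h : f (j + 1) = c
    · exact ⟨j + 1, by omega, h⟩
    · have := hf j
      exact ih (by omega)

/-- The numbers of ones in factors of length `n` form an interval symmetric about `n / 2`. -/
lemma exists_pfOnes_range (n : ℕ) : ∃ m, 2 * m ≤ n ∧
    {c | ∃ i, 1 ≤ i ∧ pfOnes n i = c} = Set.Icc m (n - m) := by
  set S := {c | ∃ i, 1 ≤ i ∧ pfOnes n i = c}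
  obtain ⟨i, hi, him⟩ : sInf S ∈ S := Nat.sInf_mem ⟨pfOnes n 1, 1, le_rfl, rfl⟩
  have hmin : ∀ k, 1 ≤ k → sInf S ≤ pfOnes n k := fun k hk => Nat.sInf_le ⟨k, hk, rfl⟩
  obtain ⟨j, hj, hij⟩ := exists_pfOnes_reflect n i hi
  have hmj := hmin j hj
  have hstep : ∀ k, pfOnes n (k + 1) ≤ pfOnes n k + 1 ∧ pfOnes n k ≤ pfOnes n (k + 1) + 1 := by
    intro k
    have := pfOnes_step n k
    have := pf_le_one k
    have := pf_le_one (k + n)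
    omega
  refine ⟨sInf S, by omega, Set.ext fun c => ⟨?_, ?_⟩⟩
  · rintro ⟨k, hk, rfl⟩
    obtain ⟨k', hk', h⟩ := exists_pfOnes_reflect n k hk
    have := hmin k hk
    have := hmin k' hk'
    exact ⟨by omega, by omega⟩
  · rintro ⟨h1, h2⟩
    rcases le_total i j with h | h
    · obtain ⟨l, hl, e⟩ := exists_eq_of_step_le_one _ hstep h c (by omega)
      exact ⟨l, by omega, e⟩
    · obtain ⟨l, hl, e⟩ := exists_eq_of_step_le_one _ hstep h c (by omega)
      exact ⟨l, by omega, e⟩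

/-- For `n ≥ 1`, the abelian complexity of the paperfolding word satisfies
`ρ(n) = M(n) + 1`. -/
theorem pf_rho_eq_M_add_one : ∀ n : ℕ, 1 ≤ n → (ρ n : ℤ) = M n + 1 := by
  intro n _
  obtain ⟨m, hm, hS⟩ := exists_pfOnes_range n
  have hmem : ∀ c, (∃ i, 1 ≤ i ∧ pfOnes n i = c) ↔ m ≤ c ∧ c ≤ n - m :=
    fun c => Set.ext_iff.mp hS c
  have hρ : ρ n = n - m + 1 - m := by
    have himage : {p : ℕ × ℕ | ∃ i : ℕ, 1 ≤ i ∧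
        p = ((pfFactor i n).count 0, (pfFactor i n).count 1)} =
        (fun c => (n - c, c)) '' Set.Icc m (n - m) := by
      rw [← hS]
      ext p
      have key : ∀ i, ((pfFactor i n).count 0, (pfFactor i n).count 1) =
          (n - pfOnes n i, pfOnes n i) := fun i => by
        rw [count_one_pfFactor, Nat.eq_sub_of_add_eq (count_zero_add_pfOnes i n)]
      simp only [key, Set.mem_ofPred_eq, Set.mem_image]
      constructor
      · rintro ⟨i, hi, rfl⟩
        exact ⟨_, ⟨i, hi, rfl⟩, rfl⟩
      · rintro ⟨_, ⟨i, hi, rfl⟩, rfl⟩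
        exact ⟨i, hi, rfl⟩
    rw [ρ, himage, Set.ncard_image_of_injective _ fun a b h => (Prod.ext_iff.mp h).2,
      ← Finset.coe_Icc, Set.ncard_coe_finset, Nat.card_Icc]
  have hΔ : ∀ i, Δ (pfFactor i n) = n - 2 * pfOnes n i := fun i => by
    have := count_zero_add_pfOnes i n
    rw [Δ, count_one_pfFactor]
    omega
  have hM : M n = n - 2 * m := by
    refine IsGreatest.csSup_eq ⟨?_, ?_⟩
    · obtain ⟨i, hi, h⟩ := (hmem m).2 ⟨le_rfl, by omega⟩
      exact ⟨i, hi, by rw [hΔ, h]⟩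
    · rintro _ ⟨i, hi, rfl⟩
      have := ((hmem _).1 ⟨i, hi, rfl⟩).1
      rw [hΔ]
      omega
  omega
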